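/- The derivability problem for !bL1 is undecidable: the predicate 'the sequent Π → A is derivable in !bL1', on the (countable, effectively encodable) set of !bL1-sequents, is not a computable (decidable) predicate. -/

import Mathlib

namespace Lambek

/-! ## Formulae of `!bL1` (Lambek calculus with unit, brackets and subexponential) -/

/-- Formulae: primitive types, the unit `1`, `\`, `/`, `·`, `⟨⟩`, `[]⁻¹`, `!`. -/
inductive Fm : Type
  | var : ℕ → Fm
  | one : Fm
  | ldiv : Fm → Fm → Fm   -- `ldiv A C` is `A \ C`
  | rdiv : Fm → Fm → Fm   -- `rdiv C B` is `C / B`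
  | mul : Fm → Fm → Fm    -- `A · B`
  | dia : Fm → Fm         -- `⟨⟩ A`
  | binv : Fm → Fm        -- `[]⁻¹ A`
  | bang : Fm → Fm        -- `! A`

/-- Items of a meta-formula: a formula or a bracketed meta-formula. -/
inductive Item : Type
  | fm : Fm → Item
  | br : List Item → Item

/-- Meta-formulae (configurations): finite ordered sequences of items. -/
abbrev Meta := List Item

/-- `!A₁, …, !Aₙ` as a meta-formula. -/
def bangs (Φ : List Fm) : Meta := Φ.map (fun F => Item.fm (Fm.bang F))

/-- A meta-formula with a designated (hole) occurrence of a meta-formula,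
possibly under nested brackets. -/
inductive Ctx : Type
  | hole : Meta → Meta → Ctx
  | br : Meta → Ctx → Meta → Ctx

/-- Plug a meta-formula into the designated occurrence. -/
def Ctx.fill : Ctx → Meta → Meta
  | Ctx.hole Δ₁ Δ₂, Γ => Δ₁ ++ Γ ++ Δ₂
  | Ctx.br Δ₁ c Δ₂, Γ => Δ₁ ++ (Item.br (c.fill Γ)) :: Δ₂

/-- Derivability in `!bL1`.  The boolean parameter says whether the rule (cut)
is allowed: `DervB true` is full `!bL1`, `DervB false` is cut-free derivability. -/
inductive DervB : Bool → Meta → Fm → Prop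
  | id (cf : Bool) (A : Fm) : DervB cf [Item.fm A] A
  | one_r (cf : Bool) : DervB cf [] Fm.one
  | rdiv_l (cf : Bool) (Δ : Ctx) (Γ : Meta) (B C D : Fm) :
      DervB cf Γ B → DervB cf (Δ.fill [Item.fm C]) D →
      DervB cf (Δ.fill (Item.fm (Fm.rdiv C B) :: Γ)) D
  | rdiv_r (cf : Bool) (Γ : Meta) (B C : Fm) :
      DervB cf (Γ ++ [Item.fm B]) C → DervB cf Γ (Fm.rdiv C B)
  | ldiv_l (cf : Bool) (Δ : Ctx) (Γ : Meta) (A C D : Fm) :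
      DervB cf Γ A → DervB cf (Δ.fill [Item.fm C]) D →
      DervB cf (Δ.fill (Γ ++ [Item.fm (Fm.ldiv A C)])) D
  | ldiv_r (cf : Bool) (Γ : Meta) (A C : Fm) :
      DervB cf (Item.fm A :: Γ) C → DervB cf Γ (Fm.ldiv A C)
  | mul_l (cf : Bool) (Δ : Ctx) (A B D : Fm) :
      DervB cf (Δ.fill [Item.fm A, Item.fm B]) D →
      DervB cf (Δ.fill [Item.fm (Fm.mul A B)]) D
  | mul_r (cf : Bool) (Γ₁ Γ₂ : Meta) (A B : Fm) :
      DervB cf Γ₁ A → DervB cf Γ₂ B → DervB cf (Γ₁ ++ Γ₂) (Fm.mul A B)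
  | one_l (cf : Bool) (Δ : Ctx) (A : Fm) :
      DervB cf (Δ.fill []) A → DervB cf (Δ.fill [Item.fm Fm.one]) A
  | dia_l (cf : Bool) (Δ : Ctx) (A C : Fm) :
      DervB cf (Δ.fill [Item.br [Item.fm A]]) C →
      DervB cf (Δ.fill [Item.fm (Fm.dia A)]) C
  | dia_r (cf : Bool) (Θ : Meta) (A : Fm) :
      DervB cf Θ A → DervB cf [Item.br Θ] (Fm.dia A)
  | binv_l (cf : Bool) (Δ : Ctx) (A C : Fm) :
      DervB cf (Δ.fill [Item.fm A]) C →
      DervB cf (Δ.fill [Item.br [Item.fm (Fm.binv A)]]) C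
  | binv_r (cf : Bool) (Θ : Meta) (A : Fm) :
      DervB cf [Item.br Θ] A → DervB cf Θ (Fm.binv A)
  | bang_l (cf : Bool) (Δ : Ctx) (A B : Fm) :
      DervB cf (Δ.fill [Item.fm A]) B → DervB cf (Δ.fill [Item.fm (Fm.bang A)]) B
  | bang_r (cf : Bool) (Φ : List Fm) (A : Fm) :
      DervB cf (bangs Φ) A → DervB cf (bangs Φ) (Fm.bang A)
  | contr (cf : Bool) (Δ : Ctx) (Φ : List Fm) (Γ : Meta) (B : Fm) :
      Φ ≠ [] →
      DervB cf (Δ.fill (bangs Φ ++ [Item.br (bangs Φ ++ Γ)])) B →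
      DervB cf (Δ.fill (bangs Φ ++ Γ)) B
  | perm1 (cf : Bool) (Δ : Ctx) (A : Fm) (Γ : Meta) (B : Fm) :
      DervB cf (Δ.fill (Item.fm (Fm.bang A) :: Γ)) B →
      DervB cf (Δ.fill (Γ ++ [Item.fm (Fm.bang A)])) B
  | perm2 (cf : Bool) (Δ : Ctx) (A : Fm) (Γ : Meta) (B : Fm) :
      DervB cf (Δ.fill (Γ ++ [Item.fm (Fm.bang A)])) B →
      DervB cf (Δ.fill (Item.fm (Fm.bang A) :: Γ)) B
  | cut (Δ : Ctx) (Θ : Meta) (A C : Fm) :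
      DervB true Θ A → DervB true (Δ.fill [Item.fm A]) C →
      DervB true (Δ.fill Θ) C

/-! ## Bracket-free formulae and the calculi `!L1` and `!wL1` -/

/-- Bracket-free formulae (language of `!L1` / `!wL1`). -/
inductive Fm0 : Type
  | var : ℕ → Fm0
  | one : Fm0
  | ldiv : Fm0 → Fm0 → Fm0
  | rdiv : Fm0 → Fm0 → Fm0
  | mul : Fm0 → Fm0 → Fm0
  | bang : Fm0 → Fm0

/-- Derivability in `!L1` / `!wL1`.  The first boolean allows the weakening
rule (`DervL true` is `!wL1`, `DervL false` is `!L1`); the second boolean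
allows the rule (cut). -/
inductive DervL : Bool → Bool → List Fm0 → Fm0 → Prop
  | id (w cf : Bool) (A : Fm0) : DervL w cf [A] A
  | one_r (w cf : Bool) : DervL w cf [] Fm0.one
  | rdiv_l (w cf : Bool) (Γ Δ₁ Δ₂ : List Fm0) (B C D : Fm0) :
      DervL w cf Γ B → DervL w cf (Δ₁ ++ C :: Δ₂) D →
      DervL w cf (Δ₁ ++ Fm0.rdiv C B :: (Γ ++ Δ₂)) D
  | rdiv_r (w cf : Bool) (Γ : List Fm0) (B C : Fm0) :
      DervL w cf (Γ ++ [B]) C → DervL w cf Γ (Fm0.rdiv C B)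
  | ldiv_l (w cf : Bool) (Γ Δ₁ Δ₂ : List Fm0) (A C D : Fm0) :
      DervL w cf Γ A → DervL w cf (Δ₁ ++ C :: Δ₂) D →
      DervL w cf (Δ₁ ++ Γ ++ Fm0.ldiv A C :: Δ₂) D
  | ldiv_r (w cf : Bool) (Γ : List Fm0) (A C : Fm0) :
      DervL w cf (A :: Γ) C → DervL w cf Γ (Fm0.ldiv A C)
  | mul_l (w cf : Bool) (Δ₁ Δ₂ : List Fm0) (A B D : Fm0) :
      DervL w cf (Δ₁ ++ A :: B :: Δ₂) D → DervL w cf (Δ₁ ++ Fm0.mul A B :: Δ₂) D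
  | mul_r (w cf : Bool) (Γ₁ Γ₂ : List Fm0) (A B : Fm0) :
      DervL w cf Γ₁ A → DervL w cf Γ₂ B → DervL w cf (Γ₁ ++ Γ₂) (Fm0.mul A B)
  | one_l (w cf : Bool) (Δ₁ Δ₂ : List Fm0) (A : Fm0) :
      DervL w cf (Δ₁ ++ Δ₂) A → DervL w cf (Δ₁ ++ Fm0.one :: Δ₂) A
  | bang_l (w cf : Bool) (Δ₁ Δ₂ : List Fm0) (A B : Fm0) :
      DervL w cf (Δ₁ ++ A :: Δ₂) B → DervL w cf (Δ₁ ++ Fm0.bang A :: Δ₂) B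
  | bang_r (w cf : Bool) (Φ : List Fm0) (A : Fm0) :
      DervL w cf (Φ.map Fm0.bang) A → DervL w cf (Φ.map Fm0.bang) (Fm0.bang A)
  | perm1 (w cf : Bool) (Δ₁ Γ Δ₂ : List Fm0) (A B : Fm0) :
      DervL w cf (Δ₁ ++ Fm0.bang A :: (Γ ++ Δ₂)) B →
      DervL w cf (Δ₁ ++ Γ ++ Fm0.bang A :: Δ₂) B
  | perm2 (w cf : Bool) (Δ₁ Γ Δ₂ : List Fm0) (A B : Fm0) :
      DervL w cf (Δ₁ ++ Γ ++ Fm0.bang A :: Δ₂) B →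
      DervL w cf (Δ₁ ++ Fm0.bang A :: (Γ ++ Δ₂)) B
  | contr (w cf : Bool) (Δ₁ Δ₂ : List Fm0) (A B : Fm0) :
      DervL w cf (Δ₁ ++ Fm0.bang A :: Fm0.bang A :: Δ₂) B →
      DervL w cf (Δ₁ ++ Fm0.bang A :: Δ₂) B
  | weak (cf : Bool) (Δ₁ Δ₂ : List Fm0) (A B : Fm0) :
      DervL true cf (Δ₁ ++ Δ₂) B → DervL true cf (Δ₁ ++ Fm0.bang A :: Δ₂) B
  | cut (w : Bool) (Θ Δ₁ Δ₂ : List Fm0) (A C : Fm0) :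
      DervL w true Θ A → DervL w true (Δ₁ ++ A :: Δ₂) C →
      DervL w true (Δ₁ ++ Θ ++ Δ₂) C

/-! ## The Lambek calculus with unit `L1` and theories `L1 + T` -/

/-- Formulae of `L1` (no `!`, no bracket modalities). -/
inductive Fm1 : Type
  | var : ℕ → Fm1
  | one : Fm1
  | ldiv : Fm1 → Fm1 → Fm1
  | rdiv : Fm1 → Fm1 → Fm1
  | mul : Fm1 → Fm1 → Fm1

/-- Sequents of `L1`. -/
abbrev Seq1 := List Fm1 × Fm1

/-- Derivability in `L1 + T` (sequents of `T` are extra axioms). -/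
inductive DervT (T : Set Seq1) : List Fm1 → Fm1 → Prop
  | id (A : Fm1) : DervT T [A] A
  | one_r : DervT T [] Fm1.one
  | ax (Γ : List Fm1) (A : Fm1) : (Γ, A) ∈ T → DervT T Γ A
  | rdiv_l (Γ Δ₁ Δ₂ : List Fm1) (B C D : Fm1) :
      DervT T Γ B → DervT T (Δ₁ ++ C :: Δ₂) D →
      DervT T (Δ₁ ++ Fm1.rdiv C B :: (Γ ++ Δ₂)) D
  | rdiv_r (Γ : List Fm1) (B C : Fm1) :
      DervT T (Γ ++ [B]) C → DervT T Γ (Fm1.rdiv C B)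
  | ldiv_l (Γ Δ₁ Δ₂ : List Fm1) (A C D : Fm1) :
      DervT T Γ A → DervT T (Δ₁ ++ C :: Δ₂) D →
      DervT T (Δ₁ ++ Γ ++ Fm1.ldiv A C :: Δ₂) D
  | ldiv_r (Γ : List Fm1) (A C : Fm1) :
      DervT T (A :: Γ) C → DervT T Γ (Fm1.ldiv A C)
  | mul_l (Δ₁ Δ₂ : List Fm1) (A B D : Fm1) :
      DervT T (Δ₁ ++ A :: B :: Δ₂) D → DervT T (Δ₁ ++ Fm1.mul A B :: Δ₂) D
  | mul_r (Γ₁ Γ₂ : List Fm1) (A B : Fm1) :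
      DervT T Γ₁ A → DervT T Γ₂ B → DervT T (Γ₁ ++ Γ₂) (Fm1.mul A B)
  | one_l (Δ₁ Δ₂ : List Fm1) (A : Fm1) :
      DervT T (Δ₁ ++ Δ₂) A → DervT T (Δ₁ ++ Fm1.one :: Δ₂) A
  | cut (Θ Δ₁ Δ₂ : List Fm1) (A C : Fm1) :
      DervT T Θ A → DervT T (Δ₁ ++ A :: Δ₂) C →
      DervT T (Δ₁ ++ Θ ++ Δ₂) C

/-- Derivability in `L1 + T` where every application of (cut) must have a
sequent from `T` as one of its premises. -/
inductive DervTr (T : Set Seq1) : List Fm1 → Fm1 → Prop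
  | id (A : Fm1) : DervTr T [A] A
  | one_r : DervTr T [] Fm1.one
  | ax (Γ : List Fm1) (A : Fm1) : (Γ, A) ∈ T → DervTr T Γ A
  | rdiv_l (Γ Δ₁ Δ₂ : List Fm1) (B C D : Fm1) :
      DervTr T Γ B → DervTr T (Δ₁ ++ C :: Δ₂) D →
      DervTr T (Δ₁ ++ Fm1.rdiv C B :: (Γ ++ Δ₂)) D
  | rdiv_r (Γ : List Fm1) (B C : Fm1) :
      DervTr T (Γ ++ [B]) C → DervTr T Γ (Fm1.rdiv C B)
  | ldiv_l (Γ Δ₁ Δ₂ : List Fm1) (A C D : Fm1) :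
      DervTr T Γ A → DervTr T (Δ₁ ++ C :: Δ₂) D →
      DervTr T (Δ₁ ++ Γ ++ Fm1.ldiv A C :: Δ₂) D
  | ldiv_r (Γ : List Fm1) (A C : Fm1) :
      DervTr T (A :: Γ) C → DervTr T Γ (Fm1.ldiv A C)
  | mul_l (Δ₁ Δ₂ : List Fm1) (A B D : Fm1) :
      DervTr T (Δ₁ ++ A :: B :: Δ₂) D → DervTr T (Δ₁ ++ Fm1.mul A B :: Δ₂) D
  | mul_r (Γ₁ Γ₂ : List Fm1) (A B : Fm1) :
      DervTr T Γ₁ A → DervTr T Γ₂ B → DervTr T (Γ₁ ++ Γ₂) (Fm1.mul A B)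
  | one_l (Δ₁ Δ₂ : List Fm1) (A : Fm1) :
      DervTr T (Δ₁ ++ Δ₂) A → DervTr T (Δ₁ ++ Fm1.one :: Δ₂) A
  | cut (Θ Δ₁ Δ₂ : List Fm1) (A C : Fm1) :
      (Θ, A) ∈ T ∨ (Δ₁ ++ A :: Δ₂, C) ∈ T →
      DervTr T Θ A → DervTr T (Δ₁ ++ A :: Δ₂) C →
      DervTr T (Δ₁ ++ Θ ++ Δ₂) C

/-- Derivability in `L1 + T` by a derivation all of whose sequents satisfy
the predicate `Good`. -/
inductive DervTgood (T : Set Seq1) (Good : List Fm1 → Fm1 → Prop) : List Fm1 → Fm1 → Prop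
  | id (A : Fm1) : Good [A] A → DervTgood T Good [A] A
  | one_r : Good [] Fm1.one → DervTgood T Good [] Fm1.one
  | ax (Γ : List Fm1) (A : Fm1) : (Γ, A) ∈ T → Good Γ A → DervTgood T Good Γ A
  | rdiv_l (Γ Δ₁ Δ₂ : List Fm1) (B C D : Fm1) :
      DervTgood T Good Γ B → DervTgood T Good (Δ₁ ++ C :: Δ₂) D →
      Good (Δ₁ ++ Fm1.rdiv C B :: (Γ ++ Δ₂)) D →
      DervTgood T Good (Δ₁ ++ Fm1.rdiv C B :: (Γ ++ Δ₂)) D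
  | rdiv_r (Γ : List Fm1) (B C : Fm1) :
      DervTgood T Good (Γ ++ [B]) C → Good Γ (Fm1.rdiv C B) →
      DervTgood T Good Γ (Fm1.rdiv C B)
  | ldiv_l (Γ Δ₁ Δ₂ : List Fm1) (A C D : Fm1) :
      DervTgood T Good Γ A → DervTgood T Good (Δ₁ ++ C :: Δ₂) D →
      Good (Δ₁ ++ Γ ++ Fm1.ldiv A C :: Δ₂) D →
      DervTgood T Good (Δ₁ ++ Γ ++ Fm1.ldiv A C :: Δ₂) D
  | ldiv_r (Γ : List Fm1) (A C : Fm1) :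
      DervTgood T Good (A :: Γ) C → Good Γ (Fm1.ldiv A C) →
      DervTgood T Good Γ (Fm1.ldiv A C)
  | mul_l (Δ₁ Δ₂ : List Fm1) (A B D : Fm1) :
      DervTgood T Good (Δ₁ ++ A :: B :: Δ₂) D →
      Good (Δ₁ ++ Fm1.mul A B :: Δ₂) D →
      DervTgood T Good (Δ₁ ++ Fm1.mul A B :: Δ₂) D
  | mul_r (Γ₁ Γ₂ : List Fm1) (A B : Fm1) :
      DervTgood T Good Γ₁ A → DervTgood T Good Γ₂ B →
      Good (Γ₁ ++ Γ₂) (Fm1.mul A B) →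
      DervTgood T Good (Γ₁ ++ Γ₂) (Fm1.mul A B)
  | one_l (Δ₁ Δ₂ : List Fm1) (A : Fm1) :
      DervTgood T Good (Δ₁ ++ Δ₂) A → Good (Δ₁ ++ Fm1.one :: Δ₂) A →
      DervTgood T Good (Δ₁ ++ Fm1.one :: Δ₂) A
  | cut (Θ Δ₁ Δ₂ : List Fm1) (A C : Fm1) :
      DervTgood T Good Θ A → DervTgood T Good (Δ₁ ++ A :: Δ₂) C →
      Good (Δ₁ ++ Θ ++ Δ₂) C →
      DervTgood T Good (Δ₁ ++ Θ ++ Δ₂) C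

/-- The formula is built from primitive types using only the product `·`. -/
def ProdOnly : Fm1 → Prop
  | Fm1.var _ => True
  | Fm1.mul A B => ProdOnly A ∧ ProdOnly B
  | _ => False

/-- A sequent contains no occurrences of `\`, `/`, `1`. -/
def ProdOnlySeq (Γ : List Fm1) (A : Fm1) : Prop :=
  (∀ F ∈ Γ, ProdOnly F) ∧ ProdOnly A

/-! ## The bracket-forgetting projection -/

/-- BFP on formulae: delete all `⟨⟩` and `[]⁻¹`. -/
def fmBFP : Fm → Fm0
  | Fm.var n => Fm0.var n
  | Fm.one => Fm0.one
  | Fm.ldiv A B => Fm0.ldiv (fmBFP A) (fmBFP B)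
  | Fm.rdiv A B => Fm0.rdiv (fmBFP A) (fmBFP B)
  | Fm.mul A B => Fm0.mul (fmBFP A) (fmBFP B)
  | Fm.dia A => fmBFP A
  | Fm.binv A => fmBFP A
  | Fm.bang A => Fm0.bang (fmBFP A)

mutual
  /-- BFP on items. -/
  def itemBFP : Item → List Fm0
    | Item.fm A => [fmBFP A]
    | Item.br Γ => metaBFP Γ
  /-- BFP on meta-formulae: delete all brackets. -/
  def metaBFP : List Item → List Fm0
    | [] => []
    | i :: Γ => itemBFP i ++ metaBFP Γ
end

/-! ## Generative grammars (semi-Thue systems) -/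

/-- A generative grammar (semi-Thue system) over symbols coded by `ℕ`. -/
structure Grammar where
  nonterminals : Finset ℕ
  terminals : Finset ℕ
  disj : Disjoint nonterminals terminals
  start : ℕ
  start_mem : start ∈ nonterminals
  prods : Finset (List ℕ × List ℕ)
  prods_wf : ∀ p ∈ prods,
    (∀ c ∈ p.1, c ∈ nonterminals ∪ terminals) ∧
    (∀ c ∈ p.2, c ∈ nonterminals ∪ terminals)

/-- One rewriting step `η α θ ⇒_G η β θ`. -/
def Grammar.Step (G : Grammar) (x y : List ℕ) : Prop :=
  ∃ p ∈ G.prods, ∃ η θ : List ℕ, x = η ++ p.1 ++ θ ∧ y = η ++ p.2 ++ θ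

/-- `⇒*_G`: reflexive-transitive closure of `⇒_G`. -/
def Grammar.Derives (G : Grammar) : List ℕ → List ℕ → Prop :=
  Relation.ReflTransGen G.Step

/-- All productions of `G` have nonempty left- and right-hand sides. -/
def Grammar.NonemptySides (G : Grammar) : Prop :=
  ∀ p ∈ G.prods, p.1 ≠ [] ∧ p.2 ≠ []

/-! ### Encoding grammars into formulae -/

/-- `u₁ · … · u_k` as an `Fm`-formula (`1` for the empty word). -/
def wordFm : List ℕ → Fm
  | [] => Fm.one
  | [a] => Fm.var a
  | a :: b :: rest => Fm.mul (Fm.var a) (wordFm (b :: rest))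

/-- `u₁ · … · u_k` as an `Fm0`-formula. -/
def wordFm0 : List ℕ → Fm0
  | [] => Fm0.one
  | [a] => Fm0.var a
  | a :: b :: rest => Fm0.mul (Fm0.var a) (wordFm0 (b :: rest))

/-- `u₁ · … · u_k` as an `Fm1`-formula. -/
def wordFm1 : List ℕ → Fm1
  | [] => Fm1.one
  | [a] => Fm1.var a
  | a :: b :: rest => Fm1.mul (Fm1.var a) (wordFm1 (b :: rest))

/-- The formula `(u₁·…·u_k) / (v₁·…·v_m)` for a production `u ⇒ v`, in `Fm`. -/
def prodFm (p : List ℕ × List ℕ) : Fm := Fm.rdiv (wordFm p.1) (wordFm p.2)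

/-- The formula `(u₁·…·u_k) / (v₁·…·v_m)` for a production `u ⇒ v`, in `Fm0`. -/
def prodFm0 (p : List ℕ × List ℕ) : Fm0 := Fm0.rdiv (wordFm0 p.1) (wordFm0 p.2)

/-- `Γ_G = !B₁, …, !Bₙ` (bracket-free). -/
noncomputable def GammaG (G : Grammar) : List Fm0 :=
  G.prods.toList.map (fun p => Fm0.bang (prodFm0 p))

/-- `Φ_G = !(1 / !B₁), …, !(1 / !Bₙ)` (bracket-free). -/
noncomputable def PhiG (G : Grammar) : List Fm0 :=
  G.prods.toList.map (fun p => Fm0.bang (Fm0.rdiv Fm0.one (Fm0.bang (prodFm0 p))))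

/-- `Γ̃_G = ![]⁻¹B₁, …, ![]⁻¹Bₙ`. -/
noncomputable def GammaTG (G : Grammar) : Meta :=
  G.prods.toList.map (fun p => Item.fm (Fm.bang (Fm.binv (prodFm p))))

/-- `Φ̃_G = !(1 / ![]⁻¹B₁), …, !(1 / ![]⁻¹Bₙ)`. -/
noncomputable def PhiTG (G : Grammar) : Meta :=
  G.prods.toList.map
    (fun p => Item.fm (Fm.bang (Fm.rdiv Fm.one (Fm.bang (Fm.binv (prodFm p))))))

/-- The theory `T_G = { v₁, …, v_m → u₁·…·u_k : (u ⇒ v) ∈ P }`. -/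
def TG (G : Grammar) : Set Seq1 :=
  { q | ∃ p ∈ G.prods, q = (p.2.map Fm1.var, wordFm1 p.1) }

/-! ## Effective encodings of sequents into `ℕ` -/

/-- An effective injective code of `!bL1`-formulae. -/
def encFm : Fm → ℕ
  | Fm.var n => Nat.pair 0 n
  | Fm.one => Nat.pair 1 0
  | Fm.ldiv A B => Nat.pair 2 (Nat.pair (encFm A) (encFm B))
  | Fm.rdiv A B => Nat.pair 3 (Nat.pair (encFm A) (encFm B))
  | Fm.mul A B => Nat.pair 4 (Nat.pair (encFm A) (encFm B))
  | Fm.dia A => Nat.pair 5 (encFm A)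
  | Fm.binv A => Nat.pair 6 (encFm A)
  | Fm.bang A => Nat.pair 7 (encFm A)

mutual
  /-- An effective injective code of items. -/
  def encItem : Item → ℕ
    | Item.fm A => Nat.pair 0 (encFm A)
    | Item.br Γ => Nat.pair 1 (encMeta Γ)
  /-- An effective injective code of meta-formulae. -/
  def encMeta : List Item → ℕ
    | [] => 0
    | i :: Γ => Nat.pair (encItem i) (encMeta Γ) + 1
end

/-- An effective injective code of `!bL1`-sequents. -/
def encSeqB (Γ : Meta) (A : Fm) : ℕ := Nat.pair (encMeta Γ) (encFm A)

/-- An effective injective code of bracket-free formulae. -/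
def encFm0 : Fm0 → ℕ
  | Fm0.var n => Nat.pair 0 n
  | Fm0.one => Nat.pair 1 0
  | Fm0.ldiv A B => Nat.pair 2 (Nat.pair (encFm0 A) (encFm0 B))
  | Fm0.rdiv A B => Nat.pair 3 (Nat.pair (encFm0 A) (encFm0 B))
  | Fm0.mul A B => Nat.pair 4 (Nat.pair (encFm0 A) (encFm0 B))
  | Fm0.bang A => Nat.pair 5 (encFm0 A)

/-- An effective injective code of `!L1`/`!wL1`-sequents. -/
def encSeq0 (Γ : List Fm0) (A : Fm0) : ℕ :=
  Nat.pair ((Γ.map encFm0).foldr (fun a r => Nat.pair a r + 1) 0) (encFm0 A)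

/-! ## Sizes -/

/-- Size (number of symbols) of a formula. -/
def fmSize : Fm → ℕ
  | Fm.var _ => 1
  | Fm.one => 1
  | Fm.ldiv A B => fmSize A + fmSize B + 1
  | Fm.rdiv A B => fmSize A + fmSize B + 1
  | Fm.mul A B => fmSize A + fmSize B + 1
  | Fm.dia A => fmSize A + 1
  | Fm.binv A => fmSize A + 1
  | Fm.bang A => fmSize A + 1

mutual
  /-- Size of an item. -/
  def itemSize : Item → ℕ
    | Item.fm A => fmSize A
    | Item.br Γ => metaSize Γ + 1
  /-- Size of a meta-formula. -/
  def metaSize : List Item → ℕ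
    | [] => 0
    | i :: Γ => itemSize i + metaSize Γ
end

/-! ## Polarity and the bracket non-negative condition -/

/-- `cleanFm pol A`: the formula `A`, all of whose subformula occurrences have
their polarity in the sequent tracked starting from `pol` (`true` = positive),
contains no `[]⁻¹`-subformula at positive polarity and no `⟨⟩`-subformula at
negative polarity. -/
def cleanFm : Bool → Fm → Prop
  | _, Fm.var _ => True
  | _, Fm.one => True
  | pol, Fm.ldiv A B => cleanFm (!pol) A ∧ cleanFm pol B
  | pol, Fm.rdiv B A => cleanFm pol B ∧ cleanFm (!pol) A
  | pol, Fm.mul A B => cleanFm pol A ∧ cleanFm pol B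
  | pol, Fm.dia A => pol = true ∧ cleanFm pol A
  | pol, Fm.binv A => pol = false ∧ cleanFm pol A
  | pol, Fm.bang A => cleanFm pol A

/-- `bnnFm pol A`: every negative occurrence of a `!`-subformula of `A`
(where `A` itself occurs at polarity `pol` in the sequent) includes no
positive occurrence of `[]⁻¹C` and no negative occurrence of `⟨⟩C`. -/
def bnnFm : Bool → Fm → Prop
  | _, Fm.var _ => True
  | _, Fm.one => True
  | pol, Fm.ldiv A B => bnnFm (!pol) A ∧ bnnFm pol B
  | pol, Fm.rdiv B A => bnnFm pol B ∧ bnnFm (!pol) A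
  | pol, Fm.mul A B => bnnFm pol A ∧ bnnFm pol B
  | pol, Fm.dia A => bnnFm pol A
  | pol, Fm.binv A => bnnFm pol A
  | pol, Fm.bang A => (pol = false → cleanFm false A) ∧ bnnFm pol A

mutual
  /-- The bracket non-negative condition for an item of an antecedent. -/
  def bnnItem : Item → Prop
    | Item.fm A => bnnFm false A
    | Item.br Γ => bnnMeta Γ
  /-- The bracket non-negative condition for an antecedent. -/
  def bnnMeta : List Item → Prop
    | [] => True
    | i :: Γ => bnnItem i ∧ bnnMeta Γ
end

/-- The sequent `Γ → C` obeys the bracket non-negative condition. -/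
def bnnSeq (Γ : Meta) (C : Fm) : Prop := bnnMeta Γ ∧ bnnFm true C

/-! ## The formulation of `!bL1` with the generalized permutation rule -/

/-- `interleave Δ₀ [(A₁,Δ₁), …, (A_k,Δ_k)] = Δ₀, !A₁, Δ₁, …, !A_k, Δ_k`. -/
def interleave : Meta → List (Fm × Meta) → Meta
  | Δ₀, [] => Δ₀
  | Δ₀, (A, Δ) :: rest => Δ₀ ++ Item.fm (Fm.bang A) :: interleave Δ rest

/-- Derivations in the formulation of `!bL1` in which `(perm₁)`, `(perm₂)` are
replaced by the generalized permutation rule `(perm)*`.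
`NDervP cf b n Γ C` means: there is a derivation of `Γ → C` in which
(cut) is allowed only if `cf = true`, no two applications of `(perm)*` are
consecutive, `b` records whether the last rule applied is `(perm)*`, and the
derivation has exactly `n` rule applications (axiom instances included). -/
inductive NDervP : Bool → Bool → ℕ → Meta → Fm → Prop
  | id (cf : Bool) (A : Fm) : NDervP cf false 1 [Item.fm A] A
  | one_r (cf : Bool) : NDervP cf false 1 [] Fm.one
  | rdiv_l (cf b₁ b₂ : Bool) (n₁ n₂ : ℕ) (Δ : Ctx) (Γ : Meta) (B C D : Fm) :
      NDervP cf b₁ n₁ Γ B → NDervP cf b₂ n₂ (Δ.fill [Item.fm C]) D →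
      NDervP cf false (n₁ + n₂ + 1) (Δ.fill (Item.fm (Fm.rdiv C B) :: Γ)) D
  | rdiv_r (cf b : Bool) (n : ℕ) (Γ : Meta) (B C : Fm) :
      NDervP cf b n (Γ ++ [Item.fm B]) C → NDervP cf false (n + 1) Γ (Fm.rdiv C B)
  | ldiv_l (cf b₁ b₂ : Bool) (n₁ n₂ : ℕ) (Δ : Ctx) (Γ : Meta) (A C D : Fm) :
      NDervP cf b₁ n₁ Γ A → NDervP cf b₂ n₂ (Δ.fill [Item.fm C]) D →
      NDervP cf false (n₁ + n₂ + 1) (Δ.fill (Γ ++ [Item.fm (Fm.ldiv A C)])) D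
  | ldiv_r (cf b : Bool) (n : ℕ) (Γ : Meta) (A C : Fm) :
      NDervP cf b n (Item.fm A :: Γ) C → NDervP cf false (n + 1) Γ (Fm.ldiv A C)
  | mul_l (cf b : Bool) (n : ℕ) (Δ : Ctx) (A B D : Fm) :
      NDervP cf b n (Δ.fill [Item.fm A, Item.fm B]) D →
      NDervP cf false (n + 1) (Δ.fill [Item.fm (Fm.mul A B)]) D
  | mul_r (cf b₁ b₂ : Bool) (n₁ n₂ : ℕ) (Γ₁ Γ₂ : Meta) (A B : Fm) :
      NDervP cf b₁ n₁ Γ₁ A → NDervP cf b₂ n₂ Γ₂ B →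
      NDervP cf false (n₁ + n₂ + 1) (Γ₁ ++ Γ₂) (Fm.mul A B)
  | one_l (cf b : Bool) (n : ℕ) (Δ : Ctx) (A : Fm) :
      NDervP cf b n (Δ.fill []) A → NDervP cf false (n + 1) (Δ.fill [Item.fm Fm.one]) A
  | dia_l (cf b : Bool) (n : ℕ) (Δ : Ctx) (A C : Fm) :
      NDervP cf b n (Δ.fill [Item.br [Item.fm A]]) C →
      NDervP cf false (n + 1) (Δ.fill [Item.fm (Fm.dia A)]) C
  | dia_r (cf b : Bool) (n : ℕ) (Θ : Meta) (A : Fm) :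
      NDervP cf b n Θ A → NDervP cf false (n + 1) [Item.br Θ] (Fm.dia A)
  | binv_l (cf b : Bool) (n : ℕ) (Δ : Ctx) (A C : Fm) :
      NDervP cf b n (Δ.fill [Item.fm A]) C →
      NDervP cf false (n + 1) (Δ.fill [Item.br [Item.fm (Fm.binv A)]]) C
  | binv_r (cf b : Bool) (n : ℕ) (Θ : Meta) (A : Fm) :
      NDervP cf b n [Item.br Θ] A → NDervP cf false (n + 1) Θ (Fm.binv A)
  | bang_l (cf b : Bool) (n : ℕ) (Δ : Ctx) (A B : Fm) :
      NDervP cf b n (Δ.fill [Item.fm A]) B →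
      NDervP cf false (n + 1) (Δ.fill [Item.fm (Fm.bang A)]) B
  | bang_r (cf b : Bool) (n : ℕ) (Φ : List Fm) (A : Fm) :
      NDervP cf b n (bangs Φ) A → NDervP cf false (n + 1) (bangs Φ) (Fm.bang A)
  | contr (cf b : Bool) (n : ℕ) (Δ : Ctx) (Φ : List Fm) (Γ : Meta) (B : Fm) :
      Φ ≠ [] →
      NDervP cf b n (Δ.fill (bangs Φ ++ [Item.br (bangs Φ ++ Γ)])) B →
      NDervP cf false (n + 1) (Δ.fill (bangs Φ ++ Γ)) B
  | permStar (cf : Bool) (n : ℕ) (Δ : Ctx) (Δ₀ : Meta) (L L' : List (Fm × Meta)) (C : Fm) :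
      L.map Prod.snd = L'.map Prod.snd →
      (L.map Prod.fst).Perm (L'.map Prod.fst) →
      NDervP cf false n (Δ.fill (interleave Δ₀ L)) C →
      NDervP cf true (n + 1) (Δ.fill (interleave Δ₀ L')) C
  | cut (b₁ b₂ : Bool) (n₁ n₂ : ℕ) (Δ : Ctx) (Θ : Meta) (A C : Fm) :
      NDervP true b₁ n₁ Θ A → NDervP true b₂ n₂ (Δ.fill [Item.fm A]) C →
      NDervP true false (n₁ + n₂ + 1) (Δ.fill Θ) C

/-! ## A finite rewriting system evaluating a partial recursive code -/

open Turing.ToPartrec (Code)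

/-- Instructions of a machine acting on nonempty stacks of lists of numbers. -/
inductive Letter : Type
  | push | zero | succ | zero₂ | succ₂ | dup | merge | drop | clear | norm | tail
  | eval : Code → Letter
  | eval₂ : Code → Letter
  | test : Code → Letter

/-- A nonempty stack of lists of numbers. -/
abbrev Stack := List ℕ × List (List ℕ)

/-- Transformations of partial stacks; multiplication is composition in diagrammatic order. -/
def Act := Part Stack → Part Stack

instance : Monoid Act where
  mul f g := fun p => g (f p)
  one := fun p => p
  mul_assoc _ _ _ := rfl
  one_mul _ := rfl
  mul_one _ := rfl

/-- The transformation induced by a partial function on stacks. -/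
def Act.lift (f : Stack → Part Stack) : Act := fun p => p.bind f

theorem Act.lift_mul (f g : Stack → Part Stack) :
    Act.lift f * Act.lift g = Act.lift fun x => (f x).bind g := by
  funext p
  exact Part.bind_assoc _ _ _

theorem Act.one_eq_lift : (1 : Act) = Act.lift Part.some := by
  funext p
  exact (Part.bind_some_right p).symm

/-- Apply a partial function to the top of a stack. -/
def onTop (f : List ℕ → Part (List ℕ)) : Stack → Part Stack
  | (v, σ) => (f v).map fun w => (w, σ)

/-- Apply a partial function to the second element of a stack. -/
def onSecond (f : List ℕ → Part (List ℕ)) : Stack → Part Stack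
  | (_, []) => Part.none
  | (a, v :: σ) => (f v).map fun w => (a, w :: σ)

/-- Increment the head of a list, the head of the empty list being `0`. -/
def incHead (v : List ℕ) : List ℕ := (v.headI + 1) :: v.tail

/-- The loop test performed by `Code.fix f`. -/
def loopTest (f : Code) (v : List ℕ) : Part (List ℕ) :=
  if v.headI = 0 then Part.some v.tail else (Code.fix f).eval v.tail

/-- The partial function computed by an instruction. -/
def Letter.step : Letter → Stack → Part Stack
  | push => fun x => Part.some ([], x.1 :: x.2)
  | zero => onTop fun v => Part.some (0 :: v)
  | succ => onTop fun v => Part.some (incHead v)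
  | zero₂ => onSecond fun v => Part.some (0 :: v)
  | succ₂ => onSecond fun v => Part.some (incHead v)
  | dup => fun x => Part.some (x.1, x.1 :: x.2)
  | merge => fun
    | (_, []) => Part.none
    | (a, v :: σ) => Part.some (a.headI :: v, σ)
  | drop => fun
    | (_, []) => Part.none
    | (_, v :: σ) => Part.some (v, σ)
  | clear => onTop fun _ => Part.some []
  | norm => onTop fun v => Part.some (v.headI :: v.tail)
  | tail => onTop fun v => Part.some v.tail
  | eval c => onTop fun v => c.eval v
  | eval₂ c => onSecond fun v => c.eval v
  | test f => onTop (loopTest f)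

/-- The transformation performed by an instruction. -/
def Letter.act (l : Letter) : Act := Act.lift l.step

/-- Rewriting rules over instruction words. -/
abbrev Rule := List Letter × List Letter

open Letter in
/-- The rules for instructions that do not mention codes. -/
def baseRules : List Rule :=
  [([succ, zero₂], [zero₂, succ]), ([zero, zero₂], [zero₂, zero]), ([push, zero₂], [zero, push]),
   ([succ, succ₂], [succ₂, succ]), ([zero, succ₂], [succ₂, zero]), ([push, succ₂], [succ, push]),
   ([succ, dup], [dup, succ, succ₂]), ([zero, dup], [dup, zero, zero₂]),
   ([push, dup], [push, push]),
   ([succ, merge], [merge, succ]), ([zero, merge], [drop, zero]), ([push, merge], [zero]),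
   ([succ, drop], [drop]), ([zero, drop], [drop]), ([push, drop], []),
   ([succ, clear], [clear]), ([zero, clear], [clear]), ([push, clear], [push]),
   ([succ, norm], [norm, succ]), ([zero, norm], [zero]), ([push, norm], [push, zero]),
   ([succ, tail], [tail]), ([zero, tail], []), ([push, tail], [push])]

open Letter in
/-- The rules for evaluating a code. -/
def codeRules : Code → List Rule
  | .zero' => [([eval .zero'], [zero])]
  | .succ => [([succ, eval .succ], [eval .succ, succ]),
      ([zero, eval .succ], [clear, zero, succ]),
      ([push, eval .succ], [push, zero, succ])]
  | .tail => [([eval .tail], [tail])]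
  | .cons f g => [([eval (.cons f g)], [dup, eval f, eval₂ g, merge]),
      ([succ, eval₂ g], [eval₂ g, succ]), ([zero, eval₂ g], [eval₂ g, zero]),
      ([push, eval₂ g], [eval g, push])] ++ (codeRules f ++ codeRules g)
  | .comp f g => [([eval (.comp f g)], [eval g, eval f])] ++ (codeRules f ++ codeRules g)
  | .case f g => [([succ, eval (.case f g)], [norm, eval g]),
      ([zero, eval (.case f g)], [eval f]),
      ([push, eval (.case f g)], [push, eval f])] ++ (codeRules f ++ codeRules g)
  | .fix f => [([eval (.fix f)], [eval f, test f]),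
      ([succ, test f], [tail, eval (.fix f)]), ([zero, test f], []),
      ([push, test f], [push])] ++ codeRules f

/-- The transformation performed by a word. -/
def runWord (w : List Letter) : Act := (w.map Letter.act).prod

theorem runWord_append (v w : List Letter) : runWord (v ++ w) = runWord v * runWord w := by
  simp [runWord]

/-- Both sides of a rule perform the same transformation. -/
def Rule.Valid (r : Rule) : Prop := runWord r.1 = runWord r.2

theorem fix_eval_eq (f : Code) (v : List ℕ) :
    (Code.fix f).eval v = (f.eval v).bind (loopTest f) := by
  ext b
  rw [Code.fix_eval]
  refine PFun.mem_fix_iff.trans ?_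
  rw [← Code.fix_eval]
  simp only [Part.mem_map_iff, Part.mem_bind_iff, loopTest]
  constructor
  · rintro (⟨w, hw, h⟩ | ⟨a, ⟨w, hw, h⟩, hb⟩)
    · refine ⟨w, hw, ?_⟩
      split_ifs at h ⊢
      simp_all
    · refine ⟨w, hw, ?_⟩
      split_ifs at h ⊢
      simp_all
  · rintro ⟨w, hw, h⟩
    split_ifs at h with h0
    · exact Or.inl ⟨w, hw, by simp_all⟩
    · exact Or.inr ⟨w.tail, ⟨w, hw, by simp [h0]⟩, h⟩

theorem runWord_lift (w : List Letter) :
    runWord w = Act.lift (w.foldr (fun l k x => (l.step x).bind k) Part.some) := by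
  induction w with
  | nil => exact Act.one_eq_lift
  | cons l w ih =>
    rw [show l :: w = [l] ++ w from rfl, runWord_append, ih]
    simp [runWord, Letter.act, Act.lift_mul]

theorem Rule.valid_of_step {r : Rule}
    (h : ∀ v σ, r.1.foldr (fun l k x => (l.step x).bind k) Part.some (v, σ) =
      r.2.foldr (fun l k x => (l.step x).bind k) Part.some (v, σ)) : r.Valid := by
  unfold Rule.Valid
  rw [runWord_lift, runWord_lift]
  congr 1
  funext ⟨v, σ⟩
  exact h v σ

theorem baseRules_valid : ∀ r ∈ baseRules, r.Valid := by
  simp only [baseRules, List.forall_mem_cons, List.not_mem_nil, false_implies, implies_true,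
    and_true]
  refine ⟨?_, ?_, ?_, ?_, ?_, ?_, ?_, ?_, ?_, ?_, ?_, ?_, ?_, ?_, ?_, ?_, ?_, ?_, ?_, ?_, ?_, ?_, ?_, ?_⟩ <;>
  · apply Rule.valid_of_step
    rintro v (_ | ⟨a, σ⟩) <;> simp [Letter.step, onTop, onSecond, incHead]

theorem codeRules_valid (c : Code) : ∀ r ∈ codeRules c, r.Valid := by
  induction c with
  | zero' =>
    simp only [codeRules, List.forall_mem_cons, List.not_mem_nil, false_implies, implies_true,
      and_true]
    apply Rule.valid_of_step
    rintro v (_ | ⟨a, σ⟩) <;> simp [Letter.step, onTop, Code.eval, pure]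
  | succ =>
    simp only [codeRules, List.forall_mem_cons, List.not_mem_nil, false_implies, implies_true,
      and_true]
    refine ⟨?_, ?_, ?_⟩ <;>
    · apply Rule.valid_of_step
      rintro v (_ | ⟨a, σ⟩) <;> simp [Letter.step, onTop, incHead, Code.eval, pure]
  | tail =>
    simp only [codeRules, List.forall_mem_cons, List.not_mem_nil, false_implies, implies_true,
      and_true]
    apply Rule.valid_of_step
    rintro v (_ | ⟨a, σ⟩) <;> simp [Letter.step, onTop, Code.eval, pure]
  | cons f g hf hg =>
    simp only [codeRules, List.forall_mem_append, List.forall_mem_cons, List.not_mem_nil,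
      false_implies, implies_true, and_true]
    refine ⟨⟨?_, ?_, ?_, ?_⟩, hf, hg⟩ <;>
    · apply Rule.valid_of_step
      rintro v (_ | ⟨a, σ⟩) <;>
      simp [Letter.step, onTop, onSecond, Code.eval, pure, Part.bind_map, Part.map_bind,
        Part.bind_some_eq_map, Part.map_map, Function.comp_def, Bind.bind]
  | comp f g hf hg =>
    simp only [codeRules, List.forall_mem_append, List.forall_mem_cons, List.not_mem_nil,
      false_implies, implies_true, and_true]
    refine ⟨?_, hf, hg⟩
    apply Rule.valid_of_step
    intro v σ
    simp [Letter.step, onTop, Code.eval, Part.bind_map, Bind.bind]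
    exact Part.map_bind _ _ _
  | case f g hf hg =>
    simp only [codeRules, List.forall_mem_append, List.forall_mem_cons, List.not_mem_nil,
      false_implies, implies_true, and_true]
    refine ⟨⟨?_, ?_, ?_⟩, hf, hg⟩ <;>
    · apply Rule.valid_of_step
      intro v σ
      simp [Letter.step, onTop, incHead, Code.eval]
  | fix f hf =>
    simp only [codeRules, List.forall_mem_append, List.forall_mem_cons, List.not_mem_nil,
      false_implies, implies_true, and_true]
    refine ⟨⟨?_, ?_, ?_, ?_⟩, hf⟩
    · apply Rule.valid_of_step
      intro v σ
      simp [Letter.step, onTop, fix_eval_eq, Part.bind_map, Part.map_bind]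
    all_goals
      apply Rule.valid_of_step
      intro v σ
      simp [Letter.step, onTop, incHead, loopTest]

/-- One rewriting step of an instruction word. -/
def RewritesStep (R : List Rule) (x y : List Letter) : Prop :=
  ∃ r ∈ R, ∃ a b : List Letter, x = a ++ r.1 ++ b ∧ y = a ++ r.2 ++ b

/-- The reflexive-transitive closure of `RewritesStep`. -/
def Rewrites (R : List Rule) : List Letter → List Letter → Prop :=
  Relation.ReflTransGen (RewritesStep R)

namespace Rewrites

variable {R : List Rule}

theorem refl (x : List Letter) : Rewrites R x x := Relation.ReflTransGen.refl

theorem trans {x y z : List Letter} (h : Rewrites R x y) (h' : Rewrites R y z) :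
    Rewrites R x z := Relation.ReflTransGen.trans h h'

theorem of_mem {x y : List Letter} (h : (x, y) ∈ R) : Rewrites R x y :=
  Relation.ReflTransGen.single ⟨_, h, [], [], by simp, by simp⟩

theorem context (a b : List Letter) {x y : List Letter} (h : Rewrites R x y) :
    Rewrites R (a ++ x ++ b) (a ++ y ++ b) := by
  refine Relation.ReflTransGen.lift (p := RewritesStep R) (fun w => a ++ w ++ b) ?_ _ _ h
  rintro _ _ ⟨r, hr, c, d, rfl, rfl⟩
  exact ⟨r, hr, a ++ c, d ++ b, by simp, by simp⟩

/-- Rewrite a factor of a word. -/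
theorem factor (a b : List Letter) {x y z t : List Letter} (h : Rewrites R x y)
    (hz : z = a ++ x ++ b) (ht : t = a ++ y ++ b) : Rewrites R z t := by
  subst hz ht
  exact h.context a b

end Rewrites

/-- A word of instructions extending or incrementing the top list. -/
def IsDigits (w : List Letter) : Prop := ∀ l ∈ w, l = .zero ∨ l = .succ

/-- The word extending the empty list on the top of the stack to the given list. -/
def digits : List ℕ → List Letter
  | [] => []
  | n :: v => digits v ++ .zero :: List.replicate n .succ

/-- The word pushing the given list. -/
def pushWord (v : List ℕ) : List Letter := .push :: digits v

theorem isDigits_digits (v : List ℕ) : IsDigits (digits v) := by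
  induction v with
  | nil => simp [IsDigits, digits]
  | cons n v ih =>
    intro l hl
    simp only [digits, List.mem_append, List.mem_cons, List.mem_replicate] at hl
    rcases hl with hl | hl | hl
    · exact ih l hl
    · exact Or.inl hl
    · exact Or.inr hl.2

theorem pushWord_cons (n : ℕ) (v : List ℕ) :
    pushWord (n :: v) = pushWord v ++ .zero :: List.replicate n .succ := rfl

namespace Rewrites

open Letter

variable {R : List Rule}

theorem replicate_slide {P : Letter} (h : ([succ, P], [P, succ]) ∈ R) (n : ℕ) :
    Rewrites R (List.replicate n succ ++ [P]) (P :: List.replicate n succ) := by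
  induction n with
  | zero => exact refl _
  | succ n ih =>
    refine (ih.factor [succ] [] (t := succ :: P :: List.replicate n succ) ?_ ?_).trans
      ((of_mem h).factor [] (List.replicate n succ) ?_ ?_) <;> simp [List.replicate_succ]

theorem replicate_absorb {P : Letter} (h : ([succ, P], [P]) ∈ R) (n : ℕ) :
    Rewrites R (List.replicate n succ ++ [P]) [P] := by
  induction n with
  | zero => exact refl _
  | succ n ih =>
    refine (ih.factor [succ] [] (t := [succ, P]) ?_ ?_).trans (of_mem h) <;>
      simp [List.replicate_succ]

theorem slide {P Q : Letter} (hs : ([succ, P], [P, succ]) ∈ R) (hz : ([zero, P], [P, zero]) ∈ R)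
    (hp : ([push, P], [Q, push]) ∈ R) {w : List Letter} (hw : IsDigits w) :
    Rewrites R (push :: w ++ [P]) (Q :: push :: w) := by
  have key : Rewrites R (w ++ [P]) (P :: w) := by
    induction w with
    | nil => exact refl _
    | cons l w ih =>
      have ih := ih fun k hk => hw k (List.mem_cons_of_mem _ hk)
      refine (ih.factor [l] [] (t := l :: P :: w) (by simp) (by simp)).trans ?_
      rcases hw l List.mem_cons_self with rfl | rfl
      · exact (of_mem hz).factor [] w (by simp) (by simp)
      · exact (of_mem hs).factor [] w (by simp) (by simp)
  exact (key.factor [push] [] (by simp) rfl).trans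
    ((of_mem hp).factor [] w (by simp) (by simp))

theorem absorb {P : Letter} {u : List Letter} (hs : ([succ, P], [P]) ∈ R)
    (hz : ([zero, P], [P]) ∈ R) (hp : ([push, P], u) ∈ R) {w : List Letter} (hw : IsDigits w) :
    Rewrites R (push :: w ++ [P]) u := by
  have key : Rewrites R (w ++ [P]) [P] := by
    induction w with
    | nil => exact refl _
    | cons l w ih =>
      have ih := ih fun k hk => hw k (List.mem_cons_of_mem _ hk)
      refine (ih.factor [l] [] (t := [l, P]) (by simp) (by simp)).trans ?_
      rcases hw l List.mem_cons_self with rfl | rfl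
      · exact of_mem hz
      · exact of_mem hs
  exact (key.factor [push] [] (by simp) rfl).trans (of_mem hp)

theorem dup_digits (hb : baseRules ⊆ R) {w : List Letter} (hw : IsDigits w) :
    Rewrites R (push :: w ++ [dup]) (push :: w ++ push :: w) := by
  induction w using List.reverseRecOn with
  | nil => exact of_mem (hb (by simp [baseRules]))
  | append_singleton w l ih =>
    have ih := ih fun k hk => hw k (by simp [hk])
    obtain ⟨l₂, h₁, h₂⟩ : ∃ l₂, Rewrites R [l, dup] [dup, l, l₂] ∧
        Rewrites R (push :: (w ++ [l]) ++ [l₂]) (l :: push :: (w ++ [l])) := by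
      rcases hw l (by simp) with rfl | rfl
      · exact ⟨zero₂, of_mem (hb (by simp [baseRules])), slide (hb (by simp [baseRules]))
          (hb (by simp [baseRules])) (hb (by simp [baseRules])) hw⟩
      · exact ⟨succ₂, of_mem (hb (by simp [baseRules])), slide (hb (by simp [baseRules]))
          (hb (by simp [baseRules])) (hb (by simp [baseRules])) hw⟩
    refine (h₁.factor (push :: w) [] (by simp) rfl).trans
      ((ih.factor [] [l, l₂] (by simp) rfl).trans (h₂.factor (push :: w) [] ?_ ?_)) <;> simp

theorem dup_pushWord (hb : baseRules ⊆ R) (v : List ℕ) :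
    Rewrites R (pushWord v ++ [dup]) (pushWord v ++ pushWord v) :=
  dup_digits hb (isDigits_digits v)

theorem drop_pushWord (hb : baseRules ⊆ R) (v : List ℕ) :
    Rewrites R (pushWord v ++ [drop]) [] :=
  absorb (hb (by simp [baseRules])) (hb (by simp [baseRules])) (hb (by simp [baseRules]))
    (isDigits_digits v)

theorem clear_pushWord (hb : baseRules ⊆ R) (v : List ℕ) :
    Rewrites R (pushWord v ++ [clear]) [push] :=
  absorb (hb (by simp [baseRules])) (hb (by simp [baseRules])) (hb (by simp [baseRules]))
    (isDigits_digits v)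

theorem tail_pushWord (hb : baseRules ⊆ R) (v : List ℕ) :
    Rewrites R (pushWord v ++ [tail]) (pushWord v.tail) := by
  cases v with
  | nil => exact of_mem (hb (by simp [baseRules, pushWord, digits]))
  | cons n v =>
    have h₁ : Rewrites R _ _ := replicate_absorb (P := tail) (hb (by simp [baseRules])) n
    have h₂ : Rewrites R [zero, tail] [] := of_mem (hb (by simp [baseRules]))
    exact (h₁.factor (pushWord v ++ [zero]) [] (by simp [pushWord_cons]) rfl).trans
      (h₂.factor (pushWord v) [] (by simp) (by simp))

theorem norm_pushWord (hb : baseRules ⊆ R) (v : List ℕ) :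
    Rewrites R (pushWord v ++ [norm]) (pushWord (v.headI :: v.tail)) := by
  cases v with
  | nil => exact of_mem (hb (by simp [baseRules, pushWord, digits]))
  | cons n v =>
    have h₁ : Rewrites R _ _ := replicate_slide (P := norm) (hb (by simp [baseRules])) n
    have h₂ : Rewrites R [zero, norm] [zero] := of_mem (hb (by simp [baseRules]))
    exact (h₁.factor (pushWord v ++ [zero]) [] (by simp [pushWord_cons]) rfl).trans
      (h₂.factor (pushWord v) (List.replicate n succ) (by simp) (by simp [pushWord_cons]))

theorem merge_pushWord (hb : baseRules ⊆ R) (v : List ℕ) :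
    Rewrites R (pushWord v ++ [merge]) (zero :: List.replicate v.headI succ) := by
  cases v with
  | nil => exact of_mem (hb (by simp [baseRules, pushWord, digits]))
  | cons n v =>
    have h₁ : Rewrites R _ _ := replicate_slide (P := merge) (hb (by simp [baseRules])) n
    have h₂ : Rewrites R [zero, merge] [drop, zero] := of_mem (hb (by simp [baseRules]))
    refine (h₁.factor (pushWord v ++ [zero]) [] (by simp [pushWord_cons]) rfl).trans
      ((h₂.factor (pushWord v) (List.replicate n succ) (by simp) rfl).trans
        ((drop_pushWord hb v).factor [] (zero :: List.replicate n succ) ?_ ?_)) <;> simp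

/-- Evaluation of a code is simulated by rewriting. -/
theorem eval_pushWord (hb : baseRules ⊆ R) {c : Code} (hc : codeRules c ⊆ R) {v w : List ℕ}
    (h : w ∈ c.eval v) : Rewrites R (pushWord v ++ [eval c]) (pushWord w) := by
  induction c generalizing v w with
  | zero' =>
    obtain rfl : w = 0 :: v := by simpa [Code.eval, pure, PFun.pure] using h
    have h₁ : Rewrites R [eval .zero'] [zero] := of_mem (hc (by simp [codeRules]))
    exact h₁.factor (pushWord v) [] (by simp) (by simp [pushWord_cons])
  | succ =>
    obtain rfl : w = [v.headI + 1] := by simpa [Code.eval, pure, PFun.pure] using h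
    cases v with
    | nil => exact of_mem (hc (by simp [codeRules, pushWord, digits]))
    | cons n v =>
      have h₁ : Rewrites R _ _ := replicate_slide (P := eval .succ) (hc (by simp [codeRules])) n
      have h₂ : Rewrites R [zero, eval .succ] [clear, zero, succ] :=
        of_mem (hc (by simp [codeRules]))
      refine (h₁.factor (pushWord v ++ [zero]) [] (by simp [pushWord_cons]) rfl).trans
        ((h₂.factor (pushWord v) (List.replicate n succ) (by simp) rfl).trans
          ((clear_pushWord hb v).factor [] (zero :: succ :: List.replicate n succ) ?_ ?_)) <;>
        simp [pushWord, digits, List.replicate_succ]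
  | tail =>
    obtain rfl : w = v.tail := by simpa [Code.eval, pure, PFun.pure] using h
    have h₁ : Rewrites R [eval .tail] [tail] := of_mem (hc (by simp [codeRules]))
    exact (h₁.factor (pushWord v) [] (by simp) rfl).trans (by simpa using tail_pushWord hb v)
  | cons f g hf hg =>
    simp only [codeRules, List.append_subset] at hc
    obtain ⟨hc, hcf, hcg⟩ := hc
    obtain ⟨a, ha, b, hb', rfl⟩ : ∃ a ∈ f.eval v, ∃ b ∈ g.eval v, w = a.headI :: b := by
      simpa [Code.eval, pure, PFun.pure, Bind.bind] using h
    have h₁ : Rewrites R [eval (.cons f g)] [dup, eval f, eval₂ g, merge] :=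
      of_mem (hc (by simp))
    have h₂ : Rewrites R (pushWord a ++ [eval₂ g]) (eval g :: pushWord a) :=
      slide (hc (by simp)) (hc (by simp)) (hc (by simp)) (isDigits_digits a)
    refine (h₁.factor (pushWord v) [] (by simp) rfl).trans
      (((dup_pushWord hb v).factor [] [eval f, eval₂ g, merge] (by simp) rfl).trans
      (((hf hcf ha).factor (pushWord v) [eval₂ g, merge] (by simp) rfl).trans
      ((h₂.factor (pushWord v) [merge] (by simp) rfl).trans
      (((hg hcg hb').factor [] (pushWord a ++ [merge]) (by simp) rfl).trans
      ((merge_pushWord hb a).factor (pushWord b) [] (by simp) (by simp [pushWord_cons]))))))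
  | comp f g hf hg =>
    simp only [codeRules, List.append_subset] at hc
    obtain ⟨hc, hcf, hcg⟩ := hc
    obtain ⟨a, ha, hw⟩ : ∃ a ∈ g.eval v, w ∈ f.eval a :=
      Part.mem_bind_iff.1 (by simpa [Code.eval, Bind.bind] using h)
    have h₁ : Rewrites R [eval (.comp f g)] [eval g, eval f] := of_mem (hc (by simp))
    exact (h₁.factor (pushWord v) [] (by simp) rfl).trans
      (((hg hcg ha).factor [] [eval f] (by simp) rfl).trans (by simpa using hf hcf hw))
  | case f g hf hg =>
    simp only [codeRules, List.append_subset] at hc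
    obtain ⟨hc, hcf, hcg⟩ := hc
    rcases v with _ | ⟨_ | n, v⟩
    · have h₁ : Rewrites R [push, eval (.case f g)] [push, eval f] := of_mem (hc (by simp))
      exact h₁.trans (hf hcf (v := []) (by simpa [Code.eval] using h))
    · have h₁ : Rewrites R [zero, eval (.case f g)] [eval f] := of_mem (hc (by simp))
      exact (h₁.factor (pushWord v) [] (by simp [pushWord_cons]) rfl).trans
        (by simpa using hf hcf (v := v) (by simpa [Code.eval] using h))
    · have h₁ : Rewrites R [succ, eval (.case f g)] [norm, eval g] := of_mem (hc (by simp))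
      refine (h₁.factor (pushWord (n :: v)) [] ?_ rfl).trans
        (((norm_pushWord hb (n :: v)).factor [] [eval g] (by simp) rfl).trans
          (by simpa using hg hcg (v := n :: v) (by simpa [Code.eval] using h)))
      simp [pushWord_cons, List.replicate_succ']
  | fix f hf =>
    simp only [codeRules, List.append_subset] at hc
    obtain ⟨hc, hcf⟩ := hc
    have h₁ : Rewrites R [eval (.fix f)] [eval f, test f] := of_mem (hc (by simp))
    rw [Code.fix_eval] at h
    refine PFun.fixInduction h fun v hv ih => ?_
    obtain ⟨u, hu, hw⟩ : ∃ u ∈ f.eval v, w ∈ loopTest f u := by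
      simpa [fix_eval_eq] using (show w ∈ (Code.fix f).eval v by rwa [Code.fix_eval])
    refine (h₁.factor (pushWord v) [] (by simp) rfl).trans
      (((hf hcf hu).factor [] [test f] (by simp) rfl).trans ?_)
    rcases u with _ | ⟨_ | n, u⟩
    · obtain rfl : w = [] := by simpa [loopTest] using hw
      exact of_mem (hc (by simp [pushWord, digits]))
    · obtain rfl : w = u := by simpa [loopTest] using hw
      have h₂ : Rewrites R [zero, test f] [] := of_mem (hc (by simp))
      exact h₂.factor (pushWord w) [] (by simp [pushWord_cons]) (by simp)
    · have h₂ : Rewrites R [succ, test f] [tail, eval (.fix f)] := of_mem (hc (by simp))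
      refine (h₂.factor (pushWord (n :: u)) [] ?_ rfl).trans
        (((tail_pushWord hb (n :: u)).factor [] [eval (.fix f)] (by simp) rfl).trans ?_)
      · simp [pushWord_cons, List.replicate_succ']
      · simpa using ih u (Part.mem_map_iff _ |>.2 ⟨_, hu, by simp⟩)

end Rewrites

/-! ## Soundness of a semantics in sets of elements of a monoid -/

section Semantics

open scoped Pointwise

variable {M : Type*} [Monoid M] (val : ℕ → M)

/-- The interpretation of a formula as a set of elements of a monoid. Bracket modalities are
ignored, and `!A` denotes `{1}` or `∅` according to whether `1` belongs to `A`. -/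
def denFm : Fm → Set M
  | .var n => {val n}
  | .one => {1}
  | .ldiv A C => {m | ∀ a ∈ denFm A, a * m ∈ denFm C}
  | .rdiv C B => {m | ∀ b ∈ denFm B, m * b ∈ denFm C}
  | .mul A B => denFm A * denFm B
  | .dia A => denFm A
  | .binv A => denFm A
  | .bang A => {m | m = 1 ∧ (1 : M) ∈ denFm A}

mutual
  /-- The interpretation of an item. -/
  def denItem : Item → Set M
    | .fm A => denFm val A
    | .br Γ => denMeta Γ
  /-- The interpretation of a meta-formula. -/
  def denMeta : List Item → Set M
    | [] => {1}
    | i :: Γ => denItem i * denMeta Γ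
end

theorem denMeta_append (Γ Δ : Meta) :
    denMeta val (Γ ++ Δ) = denMeta val Γ * denMeta val Δ := by
  induction Γ with
  | nil => simp [denMeta]
  | cons i Γ ih => simp [denMeta, ih, mul_assoc]

theorem denMeta_singleton_fm (A : Fm) : denMeta val [.fm A] = denFm val A := by
  simp [denMeta, denItem]

theorem denMeta_fill_mono (Δ : Ctx) {Γ Γ' : Meta} (h : denMeta val Γ ⊆ denMeta val Γ') :
    denMeta val (Δ.fill Γ) ⊆ denMeta val (Δ.fill Γ') := by
  induction Δ with
  | hole Δ₁ Δ₂ =>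
    simp only [Ctx.fill, denMeta_append]
    gcongr
  | br Δ₁ c Δ₂ ih =>
    simp only [Ctx.fill, denMeta_append, denMeta, denItem]
    gcongr

theorem eq_one_of_mem_denMeta_bangs {Φ : List Fm} {m : M} (h : m ∈ denMeta val (bangs Φ)) :
    m = 1 := by
  induction Φ generalizing m with
  | nil => simpa [bangs, denMeta] using h
  | cons A Φ ih =>
    obtain ⟨a, ha, b, hb, rfl⟩ := Set.mem_mul.1 (show m ∈ denItem val _ * denMeta val _ from h)
    rw [ih hb, mul_one]
    exact ha.1

theorem denFm_bang_mul_comm (A : Fm) (S : Set M) :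
    denFm val (.bang A) * S = S * denFm val (.bang A) := by
  ext m
  simp only [Set.mem_mul, denFm, Set.mem_ofPred_eq]
  constructor
  · rintro ⟨_, ⟨rfl, h⟩, b, hb, rfl⟩
    exact ⟨b, hb, 1, ⟨rfl, h⟩, by simp⟩
  · rintro ⟨b, hb, _, ⟨rfl, h⟩, rfl⟩
    exact ⟨1, ⟨rfl, h⟩, b, hb, by simp⟩

/-- Derivable sequents hold under the interpretation in sets of elements of a monoid. -/
theorem denMeta_subset_of_derv {cf : Bool} {Γ : Meta} {A : Fm} (h : DervB cf Γ A) :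
    denMeta val Γ ⊆ denFm val A := by
  induction h with
  | id | one_r => simp [denMeta, denItem, denFm]
  | rdiv_l _ Δ Γ B C D _ _ ih₁ ih₂ =>
    refine (denMeta_fill_mono val Δ ?_).trans ih₂
    rw [denMeta_singleton_fm]
    rintro _ ⟨a, ha, b, hb, rfl⟩
    exact ha b (ih₁ hb)
  | rdiv_r _ Γ B C _ ih =>
    intro m hm b hb
    refine ih ?_
    rw [denMeta_append, denMeta_singleton_fm]
    exact Set.mul_mem_mul hm hb
  | ldiv_l _ Δ Γ A C D _ _ ih₁ ih₂ =>
    refine (denMeta_fill_mono val Δ ?_).trans ih₂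
    rw [denMeta_append, denMeta_singleton_fm, denMeta_singleton_fm]
    rintro _ ⟨a, ha, b, hb, rfl⟩
    exact hb a (ih₁ ha)
  | ldiv_r _ Γ A C _ ih =>
    intro m hm a ha
    exact ih (Set.mul_mem_mul ha hm)
  | mul_l _ Δ A B D _ ih =>
    refine (denMeta_fill_mono val Δ ?_).trans ih
    simp [denMeta, denItem, denFm]
  | mul_r _ Γ₁ Γ₂ A B _ _ ih₁ ih₂ =>
    rw [denMeta_append]
    exact Set.mul_subset_mul ih₁ ih₂
  | one_l _ Δ A _ ih =>
    refine (denMeta_fill_mono val Δ ?_).trans ih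
    simp [denMeta, denItem, denFm]
  | dia_l _ Δ A C _ ih =>
    refine (denMeta_fill_mono val Δ ?_).trans ih
    simp [denMeta, denItem, denFm]
  | dia_r _ Θ A _ ih => simpa [denMeta, denItem, denFm] using ih
  | binv_l _ Δ A C _ ih =>
    refine (denMeta_fill_mono val Δ ?_).trans ih
    simp [denMeta, denItem, denFm]
  | binv_r _ Θ A _ ih => simpa [denMeta, denItem, denFm] using ih
  | bang_l _ Δ A B _ ih =>
    refine (denMeta_fill_mono val Δ ?_).trans ih
    rw [denMeta_singleton_fm, denMeta_singleton_fm]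
    rintro _ ⟨rfl, h⟩
    exact h
  | bang_r _ Φ A _ ih =>
    intro m hm
    obtain rfl := eq_one_of_mem_denMeta_bangs val hm
    exact ⟨rfl, ih hm⟩
  | contr _ Δ Φ Γ B _ _ ih =>
    refine (denMeta_fill_mono val Δ ?_).trans ih
    simp only [denMeta_append, denMeta, denItem, Set.singleton_one, mul_one]
    rintro _ ⟨a, ha, b, hb, rfl⟩
    obtain rfl := eq_one_of_mem_denMeta_bangs val ha
    exact ⟨1, ha, b, ⟨1, ha, b, hb, one_mul b⟩, rfl⟩
  | perm1 _ Δ A Γ B _ ih =>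
    refine (denMeta_fill_mono val Δ ?_).trans ih
    rw [denMeta_append, denMeta_singleton_fm, ← denFm_bang_mul_comm]
    exact subset_rfl
  | perm2 _ Δ A Γ B _ ih =>
    refine (denMeta_fill_mono val Δ ?_).trans ih
    rw [denMeta_append, denMeta_singleton_fm, ← denFm_bang_mul_comm]
    exact subset_rfl
  | cut Δ Θ A C _ _ ih₁ ih₂ =>
    refine (denMeta_fill_mono val Δ ?_).trans ih₂
    rw [denMeta_singleton_fm]
    exact ih₁

theorem denFm_wordFm (w : List ℕ) : denFm val (wordFm w) = {(w.map val).prod} := by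
  induction w using wordFm.induct with
  | case1 => simp [wordFm, denFm]
  | case2 a => simp [wordFm, denFm]
  | case3 a b w ih => simp [wordFm, denFm, ih]

theorem denMeta_vars (w : List ℕ) :
    denMeta val (w.map fun a => .fm (.var a)) = {(w.map val).prod} := by
  induction w with
  | nil => simp [denMeta]
  | cons a w ih => simp [denMeta, denItem, denFm, ih]

end Semantics

/-! ## Rewriting systems as sequents -/

/-- The word `w` as a meta-formula. -/
def varsMeta (w : List ℕ) : Meta := w.map fun a => .fm (.var a)

theorem varsMeta_append (v w : List ℕ) : varsMeta (v ++ w) = varsMeta v ++ varsMeta w :=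
  List.map_append

/-- The body `[]⁻¹ (u / v)` of the subexponential formula for a rule rewriting `v` to `u`. -/
def ruleFm (r : List ℕ × List ℕ) : Fm := .binv (prodFm (r.2, r.1))

/-- The product `!A₁ · … · !Aₙ · 1`. -/
def bangProd : List Fm → Fm
  | [] => .one
  | A :: Φ => .mul (.bang A) (bangProd Φ)

section Rewriting

variable {cf : Bool}

theorem derv_bangProd (cf : Bool) (Φ : List Fm) : DervB cf (bangs Φ) (bangProd Φ) := by
  induction Φ with
  | nil => exact .one_r cf
  | cons A Φ ih => exact .mul_r cf [_] _ _ _ (.id cf _) ih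

theorem derv_wordFm (cf : Bool) (w : List ℕ) : DervB cf (varsMeta w) (wordFm w) := by
  induction w using wordFm.induct with
  | case1 => exact .one_r cf
  | case2 a => exact .id cf _
  | case3 a b w ih => exact .mul_r cf [_] _ _ _ (.id cf _) ih

theorem derv_wordFm_left {Γ Δ : Meta} {w : List ℕ} {C : Fm}
    (h : DervB cf (Γ ++ varsMeta w ++ Δ) C) : DervB cf (Γ ++ [.fm (wordFm w)] ++ Δ) C := by
  induction w using wordFm.induct generalizing Γ with
  | case1 => exact .one_l cf (.hole Γ Δ) C h
  | case2 a => exact h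
  | case3 a b w ih =>
    refine .mul_l cf (.hole Γ Δ) _ _ C ?_
    have := ih (Γ := Γ ++ [.fm (.var a)]) (by simpa [varsMeta] using h)
    simpa [Ctx.fill] using this

/-- Contraction and dereliction of `![]⁻¹B`. -/
theorem derv_bang_binv {Γ Δ : Meta} {B C : Fm}
    (h : DervB cf (Γ ++ [.fm (.bang (.binv B)), .fm B] ++ Δ) C) :
    DervB cf (Γ ++ [.fm (.bang (.binv B))] ++ Δ) C := by
  refine .contr cf (.hole Γ Δ) [.binv B] [] C (by simp) ?_
  have h₁ := DervB.bang_l cf (.br (Γ ++ [.fm (.bang (.binv B))]) (.hole [] []) Δ) (.binv B) C (by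
    have := DervB.binv_l cf (.hole (Γ ++ [.fm (.bang (.binv B))]) Δ) B C
      (by simpa [Ctx.fill] using h)
    simpa [Ctx.fill] using this)
  simpa [Ctx.fill, bangs] using h₁

theorem derv_of_step {Φ : List Fm} {r : List ℕ × List ℕ} (hr : ruleFm r ∈ Φ) {x y : List ℕ}
    {C : Fm} (h : DervB cf (bangs Φ ++ varsMeta (x ++ r.2 ++ y)) C) :
    DervB cf (bangs Φ ++ varsMeta (x ++ r.1 ++ y)) C := by
  obtain ⟨Φ₁, Φ₂, rfl⟩ := List.append_of_mem hr
  have hΦ : bangs (Φ₁ ++ ruleFm r :: Φ₂) =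
      bangs Φ₁ ++ .fm (.bang (ruleFm r)) :: bangs Φ₂ := by simp [bangs]
  rw [hΦ, varsMeta_append, varsMeta_append] at h ⊢
  have key : DervB cf (bangs Φ₁ ++ (bangs Φ₂ ++ varsMeta x ++ [.fm (.bang (ruleFm r))]) ++
      (varsMeta r.1 ++ varsMeta y)) C := by
    have h₁ : DervB cf ((bangs Φ₁ ++ bangs Φ₂ ++ varsMeta x ++ [.fm (.bang (ruleFm r))]) ++
        [.fm (wordFm r.2)] ++ varsMeta y) C := by
      apply derv_wordFm_left
      have := DervB.perm1 cf (.hole (bangs Φ₁) (varsMeta r.2 ++ varsMeta y)) (ruleFm r)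
        (bangs Φ₂ ++ varsMeta x) C (by simpa [Ctx.fill] using h)
      simpa [Ctx.fill] using this
    have h₂ := DervB.rdiv_l cf (.hole _ _) _ _ _ _ (derv_wordFm cf r.1) h₁
    have h₃ := derv_bang_binv (Γ := bangs Φ₁ ++ bangs Φ₂ ++ varsMeta x)
      (B := prodFm (r.2, r.1)) (Δ := varsMeta r.1 ++ varsMeta y) (C := C) (cf := cf)
      (by simpa [Ctx.fill, ruleFm, prodFm] using h₂)
    simpa [ruleFm] using h₃
  have := DervB.perm2 cf (.hole (bangs Φ₁) (varsMeta r.1 ++ varsMeta y)) (ruleFm r)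
    (bangs Φ₂ ++ varsMeta x) C key
  simpa [Ctx.fill] using this

/-! ## The halting problem as derivability -/

/-- An injective code of codes of partial recursive functions. -/
def encCode : Code → ℕ
  | .zero' => Nat.pair 0 0
  | .succ => Nat.pair 1 0
  | .tail => Nat.pair 2 0
  | .cons f g => Nat.pair 3 (Nat.pair (encCode f) (encCode g))
  | .comp f g => Nat.pair 4 (Nat.pair (encCode f) (encCode g))
  | .case f g => Nat.pair 5 (Nat.pair (encCode f) (encCode g))
  | .fix f => Nat.pair 6 (encCode f)

theorem encCode_injective : Function.Injective encCode := by
  intro c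
  induction c with
  | zero' | succ | tail => rintro (_ | _) <;> simp [encCode, Nat.pair_eq_pair]
  | cons f g hf hg | comp f g hf hg | case f g hf hg =>
    rintro (_ | _) <;> simp only [encCode, Nat.pair_eq_pair] <;>
      grind [Function.Injective]
  | fix f hf =>
    rintro (_ | _) <;> simp only [encCode, Nat.pair_eq_pair] <;>
      grind [Function.Injective]

/-- An injective code of instructions. -/
def encLetter : Letter → ℕ
  | .push => Nat.pair 0 0
  | .zero => Nat.pair 1 0
  | .succ => Nat.pair 2 0
  | .zero₂ => Nat.pair 3 0
  | .succ₂ => Nat.pair 4 0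
  | .dup => Nat.pair 5 0
  | .merge => Nat.pair 6 0
  | .drop => Nat.pair 7 0
  | .clear => Nat.pair 8 0
  | .norm => Nat.pair 9 0
  | .tail => Nat.pair 10 0
  | .eval c => Nat.pair 11 (encCode c)
  | .eval₂ c => Nat.pair 12 (encCode c)
  | .test c => Nat.pair 13 (encCode c)

theorem encLetter_injective : Function.Injective encLetter := by
  intro k l
  cases k <;> cases l <;>
    simp [encLetter, Nat.pair_eq_pair, encCode_injective.eq_iff]

/-- The interpretation of primitive types as transformations of partial stacks. -/
noncomputable def letterVal : ℕ → Act := Function.extend encLetter Letter.act 1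

theorem prod_map_letterVal (w : List Letter) :
    ((w.map encLetter).map letterVal).prod = runWord w := by
  rw [List.map_map, runWord]
  congr 2
  funext l
  exact encLetter_injective.extend_apply _ _ l

/-- The subexponential formulae of a system of rules. -/
def rulesFm (R : List Rule) : List Fm :=
  R.map fun r => ruleFm (r.1.map encLetter, r.2.map encLetter)

theorem derv_of_rewrites {R : List Rule} {x : List Letter} (h : Rewrites R x []) :
    DervB cf (bangs (rulesFm R) ++ varsMeta (x.map encLetter)) (bangProd (rulesFm R)) := by
  induction h using Relation.ReflTransGen.head_induction_on with
  | refl => simpa [varsMeta] using derv_bangProd cf (rulesFm R)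
  | head h _ ih =>
    obtain ⟨r, hr, a, b, rfl, rfl⟩ := h
    have hmem : ruleFm (r.1.map encLetter, r.2.map encLetter) ∈ rulesFm R :=
      List.mem_map_of_mem hr
    have := derv_of_step hmem (x := a.map encLetter) (y := b.map encLetter)
      (by simpa only [List.map_append] using ih)
    simpa only [List.map_append] using this

theorem one_mem_denMeta_bangs {M : Type*} [Monoid M] {val : ℕ → M} {Φ : List Fm}
    (h : ∀ A ∈ Φ, (1 : M) ∈ denFm val A) : (1 : M) ∈ denMeta val (bangs Φ) := by
  induction Φ with
  | nil => simp [bangs, denMeta]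
  | cons A Φ ih =>
    rw [List.forall_mem_cons] at h
    exact ⟨1, ⟨rfl, h.1⟩, 1, ih h.2, one_mul 1⟩

theorem eq_one_of_mem_denFm_bangProd {M : Type*} [Monoid M] {val : ℕ → M} {Φ : List Fm} {m : M}
    (h : m ∈ denFm val (bangProd Φ)) : m = 1 := by
  induction Φ generalizing m with
  | nil => exact h
  | cons A Φ ih =>
    obtain ⟨a, ha, b, hb, rfl⟩ := h
    obtain rfl := ih hb
    obtain ⟨rfl, -⟩ := ha
    exact one_mul 1

theorem runWord_eq_one_of_derv {R : List Rule} (hR : ∀ r ∈ R, r.Valid) {x : List Letter}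
    (h : DervB cf (bangs (rulesFm R) ++ varsMeta (x.map encLetter)) (bangProd (rulesFm R))) :
    runWord x = 1 := by
  refine eq_one_of_mem_denFm_bangProd (denMeta_subset_of_derv letterVal h ?_)
  rw [denMeta_append, varsMeta, denMeta_vars, prod_map_letterVal]
  refine ⟨1, one_mem_denMeta_bangs fun A hA => ?_, _, rfl, one_mul _⟩
  obtain ⟨r, hr, rfl⟩ := List.mem_map.1 hA
  simp only [ruleFm, prodFm, denFm, denFm_wordFm, prod_map_letterVal]
  rintro _ rfl
  exact (one_mul _).trans (hR r hr)

theorem runWord_digits (v w : List ℕ) (σ : List (List ℕ)) :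
    runWord (digits v) (Part.some (w, σ)) = Part.some (v ++ w, σ) := by
  induction v with
  | nil => rfl
  | cons n v ih =>
    have key (n : ℕ) (a : List ℕ) : runWord (.zero :: List.replicate n .succ) (Part.some (a, σ)) =
        Part.some (n :: a, σ) := by
      induction n with
      | zero => simp [runWord, Letter.act, Letter.step, onTop, Act.lift]
      | succ n ih =>
        rw [List.replicate_succ', ← List.cons_append, runWord_append]
        refine (congrArg (runWord [.succ]) ih).trans ?_
        simp [runWord, Letter.act, Letter.step, onTop, Act.lift, incHead]
    rw [digits, runWord_append]
    exact (congrArg _ ih).trans (key n _)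

/-- The rules evaluating a code. -/
def haltRules (c : Code) : List Rule := baseRules ++ codeRules c

/-- The word evaluating a code on the input `[n]` and deleting the result. -/
def haltWord (c : Code) (n : ℕ) : List Letter := pushWord [n] ++ [.eval c] ++ [.drop]

theorem derv_haltWord_iff (c : Code) (n : ℕ) :
    DervB true (bangs (rulesFm (haltRules c)) ++ varsMeta ((haltWord c n).map encLetter))
      (bangProd (rulesFm (haltRules c))) ↔ (c.eval [n]).Dom := by
  have hb : baseRules ⊆ haltRules c := List.subset_append_left _ _
  have hc : codeRules c ⊆ haltRules c := List.subset_append_right _ _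
  constructor
  · intro h
    have h₁ := runWord_eq_one_of_derv (by
      simpa only [haltRules, List.forall_mem_append] using ⟨baseRules_valid, codeRules_valid c⟩) h
    have h₂ : Letter.act .drop (Letter.act (.eval c) (Part.some ([n], [[]]))) =
        Part.some ([], []) := by
      rw [haltWord, runWord_append, runWord_append] at h₁
      have h₃ := congrFun h₁ (Part.some ([], []))
      have h₄ : runWord (pushWord [n]) (Part.some ([], [])) = Part.some ([n], [[]]) := by
        refine Eq.trans ?_ (runWord_digits [n] [] [[]])
        show runWord ([.push] ++ digits [n]) _ = _
        rw [runWord_append]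
        refine congrArg (runWord (digits [n])) ?_
        simp [runWord, Letter.act, Letter.step, Act.lift]
      have h₅ (l : Letter) : runWord [l] = l.act := by simp [runWord]
      rw [h₅, h₅] at h₃
      rw [← h₄]
      exact h₃
    have h₃ : ([], []) ∈ Letter.act .drop (Letter.act (.eval c) (Part.some ([n], [[]]))) := by
      rw [h₂]
      exact Part.mem_some _
    obtain ⟨x, hx, -⟩ := Part.mem_bind_iff.1 h₃
    simp only [Letter.act, Act.lift, Letter.step, onTop, Part.bind_some, Part.mem_map_iff] at hx
    obtain ⟨w, hw, -⟩ := hx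
    exact Part.dom_iff_mem.2 ⟨w, hw⟩
  · intro h
    obtain ⟨w, hw⟩ := Part.dom_iff_mem.1 h
    exact derv_of_rewrites (((Rewrites.eval_pushWord hb hc hw).factor [] [.drop] rfl rfl).trans
      (Rewrites.drop_pushWord hb w))

end Rewriting

/-! ## Injectivity and primitive recursiveness of the codes -/

theorem encFm_injective : Function.Injective encFm := by
  intro A
  induction A with
  | var n | one => rintro (_ | _) <;> simp [encFm, Nat.pair_eq_pair]
  | ldiv A B hA hB | rdiv A B hA hB | mul A B hA hB =>
    rintro (_ | _) <;> simp only [encFm, Nat.pair_eq_pair] <;> grind [Function.Injective]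
  | dia A hA | binv A hA | bang A hA =>
    rintro (_ | _) <;> simp only [encFm, Nat.pair_eq_pair] <;> grind [Function.Injective]

mutual
  theorem encItem_inj : ∀ i j : Item, encItem i = encItem j → i = j
    | .fm A, .fm B, h => by
      simp only [encItem, Nat.pair_eq_pair] at h
      rw [encFm_injective h.2]
    | .br Γ, .br Δ, h => by
      simp only [encItem, Nat.pair_eq_pair] at h
      rw [encMeta_inj Γ Δ h.2]
    | .fm _, .br _, h => by simp [encItem, Nat.pair_eq_pair] at h
    | .br _, .fm _, h => by simp [encItem, Nat.pair_eq_pair] at h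
  theorem encMeta_inj : ∀ Γ Δ : List Item, encMeta Γ = encMeta Δ → Γ = Δ
    | [], [], _ => rfl
    | i :: Γ, j :: Δ, h => by
      simp only [encMeta, Nat.add_right_cancel_iff, Nat.pair_eq_pair] at h
      rw [encItem_inj i j h.1, encMeta_inj Γ Δ h.2]
    | [], _ :: _, h => by simp [encMeta] at h
    | _ :: _, [], h => by simp [encMeta] at h
end

theorem encSeqB_inj {Γ Δ : Meta} {A B : Fm} (h : encSeqB Γ A = encSeqB Δ B) : Γ = Δ ∧ A = B := by
  rw [encSeqB, encSeqB, Nat.pair_eq_pair] at h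
  exact ⟨encMeta_inj _ _ h.1, encFm_injective h.2⟩

theorem primrec_encMeta_append (Γ : Meta) {f : ℕ → Meta} (hf : Primrec fun n => encMeta (f n)) :
    Primrec fun n => encMeta (Γ ++ f n) := by
  induction Γ with
  | nil => exact hf
  | cons i Γ ih => exact Primrec.succ.comp (Primrec₂.natPair.comp (Primrec.const _) ih)

theorem primrec_encMeta_replicate_append (i : Item) (Γ : Meta) :
    Primrec fun n => encMeta (List.replicate n i ++ Γ) := by
  have h : Primrec₂ fun (_ : ℕ) (m : ℕ) => Nat.pair (encItem i) m + 1 :=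
    Primrec.succ.comp (Primrec₂.natPair.comp (Primrec.const _) Primrec.snd)
  refine (Primrec.nat_iterate Primrec.id (Primrec.const (encMeta Γ)) h).of_eq fun n => ?_
  induction n with
  | zero => rfl
  | succ n ih =>
    rw [id, Function.iterate_succ_apply', List.replicate_succ, List.cons_append, encMeta, ← ih]
    rfl

theorem primrec_encSeqB_haltWord (Γ : Meta) (A : Fm) (c : Code) :
    Primrec fun n => encSeqB (Γ ++ varsMeta ((haltWord c n).map encLetter)) A := by
  refine Primrec₂.natPair.comp (primrec_encMeta_append Γ ?_) (Primrec.const _)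
  refine (primrec_encMeta_append (varsMeta ([.push, .zero].map encLetter))
    (primrec_encMeta_replicate_append (.fm (.var (encLetter .succ)))
      (varsMeta ([.eval c, .drop].map encLetter)))).of_eq fun n => ?_
  simp [haltWord, pushWord, digits, varsMeta]

/-- Some code halts exactly on the inputs coding programs halting on `0`. -/
theorem exists_code_eval_dom : ∃ c : Code, ∀ p : Nat.Partrec.Code,
    (c.eval [Encodable.encode p]).Dom ↔ (p.eval 0).Dom := by
  have h : Partrec fun n : ℕ => (Denumerable.ofNat Nat.Partrec.Code n).eval 0 :=
    Nat.Partrec.Code.eval_part.comp (Computable.ofNat _) (Computable.const 0)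
  obtain ⟨c, hc⟩ := Turing.ToPartrec.Code.exists_code (Nat.Partrec'.part_iff₁.2 h)
  refine ⟨c, fun p => ?_⟩
  have := hc ⟨[Encodable.encode p], rfl⟩
  rw [this]
  simp [List.Vector.head]

/-- The derivability problem for `!bL1` is undecidable:
the set of codes of derivable sequents (under the effective injective coding
`encSeqB`) is not computable. -/
theorem bL_undecidable :
    ¬ ComputablePred (fun n : ℕ =>
      ∃ Γ : Meta, ∃ A : Fm, encSeqB Γ A = n ∧ DervB true Γ A) := by
  intro h
  obtain ⟨c, hc⟩ := exists_code_eval_dom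
  refine ComputablePred.halting_problem 0 (ComputablePred.computable_of_manyOneReducible ?_ h)
  refine ⟨_, (primrec_encSeqB_haltWord (bangs (rulesFm (haltRules c)))
    (bangProd (rulesFm (haltRules c))) c).to_comp.comp Computable.encode, fun p => ?_⟩
  refine ((hc p).symm.trans (derv_haltWord_iff c _).symm).trans ?_
  constructor
  · exact fun h => ⟨_, _, rfl, h⟩
  · rintro ⟨Γ, A, hΓ, h⟩
    obtain ⟨rfl, rfl⟩ := encSeqB_inj hΓ
    exact h

end Lambek
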